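/- arXiv:2012.09956 — 3 statements merged into one kernel-verified Lean document; each statement's English description precedes it below -/
import Mathlib

section
/- Let (G,f) be a SED-pair of order n. Suppose that every edge e with f(e) = −1 joins a vertex of V_+ with a vertex of V_−, and every edge e with f(e) = +1 joins two vertices of V_+. Then s[(G,f)] ≥ −n²/54. -/
open Finset

/-- The value `s_v`: the sum of weights of edges incident to `v`. -/
def sVert {V : Type*} [Fintype V] [DecidableEq V] (G : SimpleGraph V) [DecidableRel G.Adj]
    (f : Sym2 V → ℤ) (v : V) : ℤ :=
  ∑ e ∈ G.edgeFinset.filter (fun e => v ∈ e), f e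

/-- The total weight `s[(G,f)]`: the sum of weights over all edges. -/
def sSum {V : Type*} [Fintype V] [DecidableEq V] (G : SimpleGraph V) [DecidableRel G.Adj]
    (f : Sym2 V → ℤ) : ℤ :=
  ∑ e ∈ G.edgeFinset, f e

/-- `(G, f)` is a SED-pair: `f` takes values `±1` on edges, and the sum of `f` over the
closed edge-neighborhood `N[e]` (edges sharing a vertex with `e`, including `e` itself)
is at least `1` for every edge `e`. -/
def IsSEDPair {V : Type*} [Fintype V] [DecidableEq V] (G : SimpleGraph V) [DecidableRel G.Adj]
    (f : Sym2 V → ℤ) : Prop :=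
  (∀ e ∈ G.edgeFinset, f e = 1 ∨ f e = -1) ∧
  (∀ e ∈ G.edgeFinset,
    1 ≤ ∑ e' ∈ G.edgeFinset.filter (fun e' => ∃ v, v ∈ e ∧ v ∈ e'), f e')

/-- The sum over edges at `v`, written as a sum over all vertices. -/
lemma sVert_eq_sum_adj {V : Type*} [Fintype V] [DecidableEq V] (G : SimpleGraph V)
    [DecidableRel G.Adj] (f : Sym2 V → ℤ) (v : V) :
    sVert G f v = ∑ u, if G.Adj v u then f s(v, u) else 0 := by
  have himage : G.edgeFinset.filter (fun e => v ∈ e) =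
      (univ.filter (fun u => G.Adj v u)).image (fun u => s(v, u)) := by
    ext e
    induction e with
    | _ x y =>
      simp only [mem_filter, SimpleGraph.mem_edgeFinset, SimpleGraph.mem_edgeSet, Sym2.mem_iff,
        mem_image, mem_univ, true_and]
      constructor
      · rintro ⟨hxy, rfl | rfl⟩
        · exact ⟨y, hxy, rfl⟩
        · exact ⟨x, hxy.symm, Sym2.eq_swap⟩
      · rintro ⟨u, hu, he⟩
        rcases Sym2.eq_iff.1 he with ⟨rfl, rfl⟩ | ⟨rfl, rfl⟩
        · exact ⟨hu, Or.inl rfl⟩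
        · exact ⟨hu.symm, Or.inr rfl⟩
  rw [sVert, himage, sum_image, sum_filter]
  intro x _ y _ hxy
  exact Sym2.congr_right.1 hxy

/-- Each edge contributes its weight to exactly two of the vertex sums. -/
lemma sum_sVert {V : Type*} [Fintype V] [DecidableEq V] (G : SimpleGraph V)
    [DecidableRel G.Adj] (f : Sym2 V → ℤ) :
    ∑ v, sVert G f v = 2 * sSum G f := by
  simp only [sVert, sSum, sum_filter]
  rw [sum_comm, mul_sum]
  refine sum_congr rfl fun e he => ?_
  have hcard : #(univ.filter (fun v => v ∈ e)) = 2 := by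
    have heq : univ.filter (fun v => v ∈ e) = e.toFinset := by
      ext v
      simp
    rw [heq]
    exact Sym2.card_toFinset_of_not_isDiag e
      (G.not_isDiag_of_mem_edgeSet (SimpleGraph.mem_edgeFinset.1 he))
  rw [← sum_filter, sum_const, hcard]
  simp

/-- The sum over the closed neighbourhood of an edge in terms of its endpoints. -/
lemma sum_closedNeighborhood {V : Type*} [Fintype V] [DecidableEq V] (G : SimpleGraph V)
    [DecidableRel G.Adj] (f : Sym2 V → ℤ) {u w : V} (huw : G.Adj u w) :
    ∑ e' ∈ G.edgeFinset.filter (fun e' => ∃ v, v ∈ s(u, w) ∧ v ∈ e'), f e' =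
      sVert G f u + sVert G f w - f s(u, w) := by
  have hunion : G.edgeFinset.filter (fun e' => ∃ v, v ∈ s(u, w) ∧ v ∈ e') =
      G.edgeFinset.filter (fun e => u ∈ e) ∪ G.edgeFinset.filter (fun e => w ∈ e) := by
    rw [← filter_or]
    refine filter_congr fun e _ => ?_
    simp
  have hinter : G.edgeFinset.filter (fun e => u ∈ e) ∩ G.edgeFinset.filter (fun e => w ∈ e) =
      {s(u, w)} := by
    ext e
    simp only [mem_inter, mem_filter, mem_singleton]
    constructor
    · rintro ⟨⟨_, hu⟩, _, hw⟩
      exact (Sym2.mem_and_mem_iff huw.ne).1 ⟨hu, hw⟩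
    · rintro rfl
      simp [huw]
  have hsum := sum_union_inter (s₁ := G.edgeFinset.filter (fun e => u ∈ e))
    (s₂ := G.edgeFinset.filter (fun e => w ∈ e)) (f := f)
  rw [hinter, sum_singleton, ← hunion] at hsum
  rw [sVert, sVert]
  linarith

/-- The optimisation in one real variable behind the constant `1 / 54`; here `m` is the number of
negative edges and `B` the sum of the squares of the negative degrees. -/
lemma quadratic_bound {p q m B : ℝ} (hp : 0 < p) (hq : 0 < q) (hB : m ^ 2 ≤ p * B) :
    m - 27 * p * q / (2 * (p + q) ^ 3) * (B + m ^ 2 / q) +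
      (p + q) / (8 * p) * ((27 * p * q / (2 * (p + q) ^ 3)) ^ 2 * (2 * p * B + 2 * m ^ 2)
        - 4 * (27 * p * q / (2 * (p + q) ^ 3)) * (q / (p + q)) * p * m
        + p ^ 2 * (q / (p + q)) ^ 2) ≤ (p + q) ^ 2 / 54 := by
  obtain ⟨n, hn⟩ : ∃ n, n = p + q := ⟨_, rfl⟩
  have hn0 : 0 < n := by linarith
  rw [← hn]
  have hk : 27 * p * q ^ 2 ≤ 4 * n ^ 3 := by
    subst hn
    nlinarith [mul_nonneg (by linarith : 0 ≤ 4 * p + q) (sq_nonneg (2 * p - q)),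
      mul_nonneg (by linarith : 0 ≤ p + 4 * q) (sq_nonneg (2 * p - q))]
  have hpq : 27 * p * q ≤ 8 * n ^ 2 := by
    subst hn
    nlinarith [sq_nonneg (p - q)]
  have key : n ^ 2 / 54 - (m - 27 * p * q / (2 * n ^ 3) * (B + m ^ 2 / q) +
      n / (8 * p) * ((27 * p * q / (2 * n ^ 3)) ^ 2 * (2 * p * B + 2 * m ^ 2)
        - 4 * (27 * p * q / (2 * n ^ 3)) * (q / n) * p * m + p ^ 2 * (q / n) ^ 2)) =
      27 * q / (16 * n ^ 5) * (8 * n ^ 2 - 27 * p * q) * (p * B - m ^ 2) +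
      (4 * n ^ 3 - 27 * p * q ^ 2) * (n ^ 2 - 27 * m) ^ 2 / (216 * n ^ 5) := by
    have hq' : q = n - p := by linarith
    have hnp : n - p ≠ 0 := by
      rw [← hq']
      exact hq.ne'
    rw [hq']
    field_simp
    ring
  have h1 : 0 ≤ 27 * q / (16 * n ^ 5) * (8 * n ^ 2 - 27 * p * q) * (p * B - m ^ 2) :=
    mul_nonneg (mul_nonneg (by positivity) (by linarith)) (by linarith)
  have h2 : 0 ≤ (4 * n ^ 3 - 27 * p * q ^ 2) * (n ^ 2 - 27 * m) ^ 2 / (216 * n ^ 5) :=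
    div_nonneg (mul_nonneg (by linarith) (sq_nonneg _)) (by positivity)
  linarith

/-- A tangent parabola dominating `x ↦ max 0 (x - 1)`, weighted by `a ∈ {0, 1}`. -/
lemma weighted_tangent_bound {p q a x : ℝ} (hp : 0 < p) (hq : 0 < q) (ha : a = 0 ∨ a = 1) :
    a * (x - 1) ≤ (p + q) / (4 * p) * (x - q / (p + q)) ^ 2 := by
  have hn : 0 < p + q := by linarith
  rcases ha with rfl | rfl
  · rw [zero_mul]
    positivity
  · have hid : (p + q) / (4 * p) * (x - q / (p + q)) ^ 2 - 1 * (x - 1) =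
        (p + q) / (4 * p) * (x - 1 - p / (p + q)) ^ 2 := by
      field_simp
      ring
    have : 0 ≤ (p + q) / (4 * p) * (x - 1 - p / (p + q)) ^ 2 := by positivity
    linarith

/-- Weighted form of the bound: `A` is the adjacency matrix of the positive edges inside `P`,
and `N` is that of the negative edges between `P` and `Q`. -/
lemma bipartite_weight_bound {V : Type*} (P Q : Finset V) (A N : V → V → ℝ)
    (hA : ∀ u v, A u v = 0 ∨ A u v = 1) (hsymm : ∀ u v, A u v = A v u)
    (hN : ∀ v ∈ P, ∀ w ∈ Q,
      0 ≤ N v w * (∑ u ∈ P, A v u - ∑ z ∈ Q, N v z - ∑ z ∈ P, N z w)) :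
    2 * ∑ v ∈ P, ∑ w ∈ Q, N v w - ∑ v ∈ P, ∑ u ∈ P, A v u ≤
      ((#P : ℝ) + #Q) ^ 2 / 27 := by
  have hApos : 0 ≤ ∑ v ∈ P, ∑ u ∈ P, A v u :=
    sum_nonneg fun v _ => sum_nonneg fun u _ => by rcases hA v u with h | h <;> simp [h]
  rcases P.eq_empty_or_nonempty with rfl | hPne
  · simp only [sum_empty]
    have : (0 : ℝ) ≤ (#(∅ : Finset V) + #Q : ℝ) ^ 2 / 27 := by positivity
    linarith
  rcases Q.eq_empty_or_nonempty with rfl | hQne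
  · simp only [sum_empty, sum_const_zero]
    have : (0 : ℝ) ≤ (#P + #(∅ : Finset V) : ℝ) ^ 2 / 27 := by positivity
    linarith
  have hp : (0 : ℝ) < #P := by exact_mod_cast hPne.card_pos
  have hq : (0 : ℝ) < #Q := by exact_mod_cast hQne.card_pos
  set p : ℝ := (#P : ℝ) with hpdef
  set q : ℝ := (#Q : ℝ)
  set b : V → ℝ := fun v => ∑ w ∈ Q, N v w with hb
  set d : V → ℝ := fun w => ∑ v ∈ P, N v w
  set m : ℝ := ∑ v ∈ P, b v with hm
  set B : ℝ := ∑ v ∈ P, b v ^ 2 with hBdef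
  have hmd : m = ∑ w ∈ Q, d w := sum_comm
  have hB : m ^ 2 ≤ p * B := sq_sum_le_card_mul_sum_sq
  have hD : m ^ 2 / q ≤ ∑ w ∈ Q, d w ^ 2 := by
    rw [div_le_iff₀' hq, hmd]
    exact sq_sum_le_card_mul_sum_sq
  have hmain : B + ∑ w ∈ Q, d w ^ 2 ≤ ∑ v ∈ P, ∑ u ∈ P, A v u * b v := by
    have hnonneg : 0 ≤ ∑ v ∈ P, ∑ w ∈ Q, N v w * (∑ u ∈ P, A v u - b v - d w) :=
      sum_nonneg fun v hv => sum_nonneg fun w hw => hN v hv w hw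
    have hsplit : ∑ v ∈ P, ∑ w ∈ Q, N v w * (∑ u ∈ P, A v u - b v - d w) =
        ∑ v ∈ P, ∑ u ∈ P, A v u * b v - B - ∑ v ∈ P, ∑ w ∈ Q, N v w * d w := by
      rw [hBdef, ← sum_sub_distrib, ← sum_sub_distrib]
      refine sum_congr rfl fun v _ => ?_
      simp only [mul_sub, sum_sub_distrib, ← sum_mul]
      simp only [hb]
      ring
    have hdsq : ∑ v ∈ P, ∑ w ∈ Q, N v w * d w = ∑ w ∈ Q, d w ^ 2 := by
      rw [sum_comm]
      refine sum_congr rfl fun w _ => ?_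
      rw [← sum_mul, sq]
    linarith
  set l : ℝ := 27 * p * q / (2 * (p + q) ^ 3) with hl
  have hl0 : 0 ≤ l := by positivity
  have hpairs : ∑ v ∈ P, ∑ u ∈ P, A v u * (l * (b v + b u) - 1) ≤
      (p + q) / (4 * p) * (l ^ 2 * (2 * p * B + 2 * m ^ 2)
        - 4 * l * (q / (p + q)) * p * m + p ^ 2 * (q / (p + q)) ^ 2) := by
    calc _ ≤ ∑ v ∈ P, ∑ u ∈ P,
          (p + q) / (4 * p) * (l * (b v + b u) - q / (p + q)) ^ 2 :=
          sum_le_sum fun v _ => sum_le_sum fun u _ => weighted_tangent_bound hp hq (hA v u)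
      _ = _ := by
          simp only [← mul_sum]
          congr 1
          have hexp : ∀ v u, (l * (b v + b u) - q / (p + q)) ^ 2 =
              l ^ 2 * b v ^ 2 + l ^ 2 * b u ^ 2 + 2 * l ^ 2 * b v * b u
              - 2 * l * (q / (p + q)) * b v - 2 * l * (q / (p + q)) * b u
              + (q / (p + q)) ^ 2 := fun v u => by ring
          simp only [hexp, sum_add_distrib, sum_sub_distrib, sum_const, nsmul_eq_mul,
            ← mul_sum, ← sum_mul]
          rw [← hm, ← hBdef, ← hpdef]
          ring
  have hexpand : ∑ v ∈ P, ∑ u ∈ P, A v u * (l * (b v + b u) - 1) =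
      2 * l * ∑ v ∈ P, ∑ u ∈ P, A v u * b v - ∑ v ∈ P, ∑ u ∈ P, A v u := by
    have hswap : ∑ v ∈ P, ∑ u ∈ P, A v u * b u = ∑ v ∈ P, ∑ u ∈ P, A v u * b v := by
      rw [sum_comm]
      exact sum_congr rfl fun v _ => sum_congr rfl fun u _ => by rw [hsymm]
    have hterm : ∀ v u, A v u * (l * (b v + b u) - 1) =
        l * (A v u * b v) + l * (A v u * b u) - A v u := fun v u => by ring
    simp only [hterm, sum_add_distrib, sum_sub_distrib, ← mul_sum]
    rw [hswap]
    ring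
  have hquad := quadratic_bound hp hq hB
  rw [← hl] at hquad
  have hmul := mul_le_mul_of_nonneg_left ((add_le_add_right hD B).trans hmain) hl0
  have hhalf : (p + q) / (4 * p) = 2 * ((p + q) / (8 * p)) := by
    field_simp
    ring
  rw [hhalf, hexpand] at hpairs
  linarith

/-- Let `(G, f)` be a SED-pair of order `n` such that every edge of weight
`-1` joins a vertex of `V₊ = {v : s_v ≥ 0}` with a vertex of `V₋ = {v : s_v < 0}`, and every
edge of weight `+1` joins two vertices of `V₊`. Then `s[(G,f)] ≥ -n² / 54`. -/
theorem sed_structured_lower_bound {V : Type*} [Fintype V] [DecidableEq V]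
    (G : SimpleGraph V) [DecidableRel G.Adj] (f : Sym2 V → ℤ)
    (h : IsSEDPair G f)
    (hneg : ∀ u w : V, G.Adj u w → f s(u, w) = -1 →
      (0 ≤ sVert G f u ∧ sVert G f w < 0) ∨ (0 ≤ sVert G f w ∧ sVert G f u < 0))
    (hpos : ∀ u w : V, G.Adj u w → f s(u, w) = 1 →
      0 ≤ sVert G f u ∧ 0 ≤ sVert G f w) :
    (sSum G f : ℝ) ≥ -(Fintype.card V : ℝ) ^ 2 / 54 := by
  set P : Finset V := univ.filter (fun v => 0 ≤ sVert G f v)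
  set Q : Finset V := univ.filter (fun v => ¬ 0 ≤ sVert G f v)
  set A : V → V → ℝ := fun u v => if G.Adj u v ∧ f s(u, v) = 1 then 1 else 0 with hAdef
  set N : V → V → ℝ := fun u v => if G.Adj u v ∧ f s(u, v) = -1 then 1 else 0 with hNdef
  have hAsymm : ∀ u v, A u v = A v u := fun u v => by
    simp only [hAdef, G.adj_comm u v, Sym2.eq_swap (a := u)]
  have hNsymm : ∀ u v, N u v = N v u := fun u v => by
    simp only [hNdef, G.adj_comm u v, Sym2.eq_swap (a := u)]
  have hvert : ∀ v, (sVert G f v : ℝ) = ∑ u, A v u - ∑ u, N v u := fun v => by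
    rw [sVert_eq_sum_adj, ← sum_sub_distrib]
    push_cast
    refine sum_congr rfl fun u _ => ?_
    by_cases hadj : G.Adj v u
    · rcases h.1 s(v, u) (by simpa using hadj) with h1 | h1 <;> simp [hAdef, hNdef, hadj, h1]
    · simp [hAdef, hNdef, hadj]
  have hAQ : ∀ u v, v ∈ Q → A u v = 0 := fun u v hv => by
    refine if_neg fun hc => ?_
    exact (mem_filter.1 hv).2 (hpos u v hc.1 hc.2).2
  have hNPP : ∀ u ∈ P, ∀ v ∈ P, N u v = 0 := fun u hu v hv => by
    refine if_neg fun hc => ?_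
    have h1 := (mem_filter.1 hu).2
    have h2 := (mem_filter.1 hv).2
    rcases hneg u v hc.1 hc.2 with h3 | h3 <;> omega
  have hNQQ : ∀ u ∈ Q, ∀ v ∈ Q, N u v = 0 := fun u hu v hv => by
    refine if_neg fun hc => ?_
    have h1 := (mem_filter.1 hu).2
    have h2 := (mem_filter.1 hv).2
    rcases hneg u v hc.1 hc.2 with h3 | h3 <;> omega
  have hsplit : ∀ g : V → ℝ, ∑ v, g v = ∑ v ∈ P, g v + ∑ v ∈ Q, g v := fun g =>
    (sum_filter_add_sum_filter_not univ _ g).symm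
  have hvertP : ∀ v ∈ P, (sVert G f v : ℝ) = ∑ u ∈ P, A v u - ∑ w ∈ Q, N v w := fun v hv => by
    rw [hvert, hsplit, hsplit, sum_eq_zero fun w hw => hAQ v w hw,
      sum_eq_zero fun u hu => hNPP v hv u hu, add_zero, zero_add]
  have hvertQ : ∀ w ∈ Q, (sVert G f w : ℝ) = -∑ v ∈ P, N v w := fun w hw => by
    rw [hvert, hsplit (N w), sum_eq_zero fun u _ => (hAsymm w u).trans (hAQ u w hw),
      sum_eq_zero fun u hu => hNQQ w hw u hu, add_zero, zero_sub]
    simp only [hNsymm w]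
  have hbound := bipartite_weight_bound P Q A N
    (fun u v => by
      simp only [hAdef]
      split_ifs <;> simp)
    hAsymm
    (fun v hv w hw => by
      by_cases hc : G.Adj v w ∧ f s(v, w) = -1
      · have he := h.2 s(v, w) (by simpa using hc.1)
        rw [sum_closedNeighborhood G f hc.1, hc.2] at he
        have he' : (0 : ℝ) ≤ sVert G f v + sVert G f w := by
          exact_mod_cast (by linarith : 0 ≤ sVert G f v + sVert G f w)
        rw [hvertP v hv, hvertQ w hw] at he'
        exact mul_nonneg (by rw [show N v w = 1 from if_pos hc]; exact zero_le_one)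
          (by linarith)
      · rw [show N v w = 0 from if_neg hc, zero_mul])
  have htotal : (2 : ℝ) * sSum G f =
      ∑ v ∈ P, ∑ u ∈ P, A v u - 2 * ∑ v ∈ P, ∑ w ∈ Q, N v w := by
    have hsum : (∑ v, (sVert G f v : ℝ)) = 2 * sSum G f := by exact_mod_cast sum_sVert G f
    rw [← hsum, hsplit, sum_congr rfl hvertP, sum_congr rfl hvertQ, sum_sub_distrib,
      sum_neg_distrib, sum_comm (s := Q)]
    ring
  have hcard : (Fintype.card V : ℝ) = #P + #Q := by
    have := hsplit fun _ => 1
    simpa using this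
  rw [hcard]
  linarith
end

section
/- Let (G,f) be a SED-pair with V_− nonempty, and let x = max_{v∈V_−}(−s_v). Then ∑_{v∈V_+} s_v ≥ x². -/
open Finset

/-- The weight of the closed neighbourhood of an edge `uv` is `s_u + s_v - f (uv)`. -/
lemma sum_closedEdgeNbhd_add {V : Type*} [Fintype V] [DecidableEq V]
    (G : SimpleGraph V) [DecidableRel G.Adj] (f : Sym2 V → ℤ) {u v : V} (huv : G.Adj u v) :
    (∑ e ∈ G.edgeFinset.filter (fun e => ∃ w, w ∈ s(u, v) ∧ w ∈ e), f e) + f s(u, v) =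
      sVert G f u + sVert G f v := by
  have hunion : G.edgeFinset.filter (fun e => ∃ w, w ∈ s(u, v) ∧ w ∈ e) =
      G.edgeFinset.filter (fun e => u ∈ e) ∪ G.edgeFinset.filter (fun e => v ∈ e) := by
    ext e
    simp only [mem_filter, mem_union, Sym2.mem_iff, or_and_right, exists_or, exists_eq_left]
    tauto
  have hinter : G.edgeFinset.filter (fun e => u ∈ e) ∩ G.edgeFinset.filter (fun e => v ∈ e) =
      {s(u, v)} := by
    ext e
    simp only [mem_filter, mem_inter, mem_singleton]
    constructor
    · rintro ⟨⟨-, hu⟩, -, hv⟩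
      exact (Sym2.mem_and_mem_iff huv.ne).1 ⟨hu, hv⟩
    · rintro rfl
      simp [huv]
  rw [hunion, ← sum_singleton f s(u, v), ← hinter, sum_union_inter]
  rfl

/-- The endpoints of an edge of a SED-pair have nonnegative total value. -/
lemma IsSEDPair.sVert_add_nonneg {V : Type*} [Fintype V] [DecidableEq V]
    {G : SimpleGraph V} [DecidableRel G.Adj] {f : Sym2 V → ℤ} (h : IsSEDPair G f)
    {u v : V} (huv : G.Adj u v) : 0 ≤ sVert G f u + sVert G f v := by
  have he : s(u, v) ∈ G.edgeFinset := by simpa using huv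
  have hsum := sum_closedEdgeNbhd_add G f huv
  have hone := h.2 _ he
  rcases h.1 _ he with hf | hf <;> linarith

lemma IsSEDPair.neg_sVert_le_degree {V : Type*} [Fintype V] [DecidableEq V]
    {G : SimpleGraph V} [DecidableRel G.Adj] {f : Sym2 V → ℤ} (h : IsSEDPair G f) (v : V) :
    -sVert G f v ≤ G.degree v := by
  rw [← G.card_incidenceFinset_eq_degree, G.incidenceFinset_eq_filter, sVert, ← sum_neg_distrib,
    card_eq_sum_ones, Nat.cast_sum]
  refine sum_le_sum fun e he => ?_
  rcases h.1 e (mem_filter.1 he).1 with hf | hf <;> simp [hf]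

/-- Let `(G, f)` be a SED-pair with `V₋ = {v : s_v < 0}` nonempty and
`x = max_{v ∈ V₋} (-s_v)`. Then `∑_{v ∈ V₊} s_v ≥ x²`. -/
theorem sed_Vpos_sum_ge_sq {V : Type*} [Fintype V] [DecidableEq V]
    (G : SimpleGraph V) [DecidableRel G.Adj] (f : Sym2 V → ℤ)
    (h : IsSEDPair G f)
    (hne : (univ.filter (fun v => sVert G f v < 0)).Nonempty)
    (x : ℤ)
    (hx : x = (univ.filter (fun v => sVert G f v < 0)).sup' hne (fun v => -sVert G f v)) :
    ∑ v ∈ univ.filter (fun v => 0 ≤ sVert G f v), sVert G f v ≥ x ^ 2 := by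
  obtain ⟨v, hv, hvx⟩ := exists_mem_eq_sup' hne (fun v => -sVert G f v)
  rw [← hx] at hvx
  have hneg : sVert G f v < 0 := (mem_filter.1 hv).2
  have hnbr : ∀ u ∈ G.neighborFinset v, x ≤ sVert G f u := fun u hu => by
    linarith [h.sVert_add_nonneg ((G.mem_neighborFinset v u).1 hu)]
  calc x ^ 2 = x * x := sq x
    _ ≤ G.degree v * x := by
      have hdeg := h.neg_sVert_le_degree v
      exact mul_le_mul_of_nonneg_right (by linarith) (by linarith)
    _ = (G.neighborFinset v).card • x := by simp
    _ ≤ ∑ u ∈ G.neighborFinset v, sVert G f u := card_nsmul_le_sum _ _ _ hnbr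
    _ ≤ ∑ u ∈ univ.filter (fun u => 0 ≤ sVert G f u), sVert G f u := by
      refine sum_le_sum_of_subset_of_nonneg (fun u hu => ?_) fun u hu _ => (mem_filter.1 hu).2
      exact mem_filter.2 ⟨mem_univ u, by linarith [hnbr u hu]⟩
end

section
/- Let (G,f) be a SED-pair of order n with V_− nonempty, and let x = max_{v∈V_−}(−s_v). Then ∑_{v∈V} s_v ≥ −x·(n − |V_+| − x). -/
open Finset

theorem sVert_eq_sum_neighborFinset {V : Type*} [Fintype V] [DecidableEq V] (G : SimpleGraph V)
    [DecidableRel G.Adj] (f : Sym2 V → ℤ) (v : V) :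
    sVert G f v = ∑ w ∈ G.neighborFinset v, f s(v, w) := by
  symm
  refine Finset.sum_bij (fun w _ => s(v, w)) ?_ ?_ ?_ (fun _ _ => rfl)
  · intro w hw
    simpa using hw
  · intro a _ b _ hab
    exact Sym2.congr_right.mp hab
  · intro e he
    simp only [mem_filter, SimpleGraph.mem_edgeFinset] at he
    obtain ⟨he, w, rfl⟩ := he
    exact ⟨w, by simpa using he, rfl⟩

/-- On an edge `vw`, the closed-neighbourhood sum is `s_v + s_w - f (vw)`. -/
theorem IsSEDPair.one_add_le_sVert_add {V : Type*} [Fintype V] [DecidableEq V] {G : SimpleGraph V}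
    [DecidableRel G.Adj] {f : Sym2 V → ℤ} (h : IsSEDPair G f) {v w : V} (hvw : G.Adj v w) :
    1 + f s(v, w) ≤ sVert G f v + sVert G f w := by
  have hsum := h.2 s(v, w) (by simpa using hvw)
  have hunion : G.edgeFinset.filter (fun e' => ∃ u, u ∈ s(v, w) ∧ u ∈ e') =
      G.edgeFinset.filter (fun e => v ∈ e) ∪ G.edgeFinset.filter (fun e => w ∈ e) := by
    rw [← filter_or]
    simp
  have hinter : G.edgeFinset.filter (fun e => v ∈ e) ∩ G.edgeFinset.filter (fun e => w ∈ e) =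
      {s(v, w)} := by
    ext e
    rw [← filter_and, mem_filter, Sym2.mem_and_mem_iff hvw.ne, mem_singleton]
    constructor
    · exact fun he => he.2
    · rintro rfl
      simpa using hvw
  have hadd := Finset.sum_union_inter (f := f)
    (s₁ := G.edgeFinset.filter (fun e => v ∈ e)) (s₂ := G.edgeFinset.filter (fun e => w ∈ e))
  rw [hinter, sum_singleton, ← hunion] at hadd
  unfold sVert
  linarith

/-- A vertex has at least `-s_v` neighbours along edges of weight `-1`. -/
theorem IsSEDPair.neg_sVert_le_card {V : Type*} [Fintype V] [DecidableEq V] {G : SimpleGraph V}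
    [DecidableRel G.Adj] {f : Sym2 V → ℤ} (h : IsSEDPair G f) (v : V) :
    -sVert G f v ≤ #((G.neighborFinset v).filter (fun w => f s(v, w) = -1)) := by
  rw [sVert_eq_sum_neighborFinset, ← sum_neg_distrib, card_filter]
  push_cast
  refine sum_le_sum fun w hw => ?_
  have := h.1 s(v, w) (by simpa using hw)
  split_ifs <;> omega

/-- Let `(G, f)` be a SED-pair of order `n` with `V₋ = {v : s_v < 0}`
nonempty and `x = max_{v ∈ V₋} (-s_v)`. Then `∑_{v ∈ V} s_v ≥ -x·(n - |V₊| - x)`. -/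
theorem sed_total_sum_ge' {V : Type*} [Fintype V] [DecidableEq V]
    (G : SimpleGraph V) [DecidableRel G.Adj] (f : Sym2 V → ℤ)
    (h : IsSEDPair G f)
    (hne : (univ.filter (fun v => sVert G f v < 0)).Nonempty)
    (x : ℤ)
    (hx : x = (univ.filter (fun v => sVert G f v < 0)).sup' hne (fun v => -sVert G f v)) :
    ∑ v : V, sVert G f v ≥
      -x * ((Fintype.card V : ℤ) - ((univ.filter (fun v => 0 ≤ sVert G f v)).card : ℤ) - x) := by
  obtain ⟨v, hv, hvx⟩ := exists_mem_eq_sup' hne (fun v => -sVert G f v)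
  rw [← hx] at hvx
  have hle : ∀ u, sVert G f u < 0 → -sVert G f u ≤ x := fun u hu =>
    hx ▸ le_sup' (fun v => -sVert G f v) (by simpa using hu)
  have hxpos : 0 < x := by
    have := (mem_filter.mp hv).2
    omega
  set T := (G.neighborFinset v).filter (fun w => f s(v, w) = -1) with hT
  have hcard : x ≤ #T := hvx ▸ h.neg_sVert_le_card v
  have hTx : ∀ w ∈ T, x ≤ sVert G f w := by
    intro w hw
    rw [hT, mem_filter, SimpleGraph.mem_neighborFinset] at hw
    have := h.one_add_le_sVert_add hw.1
    omega
  have hpoint : ∀ u, (if u ∈ T then x else 0) - (if sVert G f u < 0 then x else 0) ≤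
      sVert G f u := by
    intro u
    have h₁ := hle u
    have h₂ := hTx u
    split_ifs <;> grind
  have hsum := sum_le_sum (s := univ) fun u _ => hpoint u
  have hcompl : #(univ.filter (fun u => sVert G f u < 0)) +
      #(univ.filter (fun u => 0 ≤ sVert G f u)) = Fintype.card V := by
    simpa only [not_lt, card_univ] using
      card_filter_add_card_filter_not (s := univ) (fun u => sVert G f u < 0)
  rw [sum_sub_distrib, ← sum_filter, ← sum_filter, sum_const, sum_const, filter_univ_mem,
    nsmul_eq_mul, nsmul_eq_mul] at hsum
  rw [← hcompl]
  push_cast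
  nlinarith
end
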